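/- Let m ∈ ℝ, ρ, δ ≥ 0 and τ > 0. Then: (i) every σ ∈ S^m_{ρ,δ} belongs to S̃^m_{ρ,δ}; and (ii) every σ ∈ S̃^m_{ρ,δ} is smooth in (x,ξ) and belongs to S^m_{ρ,δ+τ}. In other words, S^m_{ρ,δ} ⊆ S̃^m_{ρ,δ} ⊆ S^m_{ρ,δ+τ} for every τ > 0. -/

import Mathlib

open MeasureTheory Complex
open scoped RealInnerProductSpace ENNReal NNReal

noncomputable section

abbrev En (n : ℕ) : Type := EuclideanSpace ℝ (Fin n)

/-- Image of an integer vector `k ∈ ℤⁿ` in `ℝⁿ`. -/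
def intVec (n : ℕ) (k : Fin n → ℤ) : En n :=
  (EuclideanSpace.equiv (Fin n) ℝ).symm fun i => (k i : ℝ)

/-- The unit coordinate vector `eᵢ` of `ℝⁿ`. -/
def unitE (n : ℕ) (i : Fin n) : En n := EuclideanSpace.single i 1

/-- Iterated directional (partial) derivative along the list of directions `L`. -/
def pdSeq {V : Type*} [NormedAddCommGroup V] [NormedSpace ℝ V] (L : List V) (f : V → ℂ) :
    V → ℂ :=
  L.foldr (fun v g => fun x => fderiv ℝ g x v) f

/-- The list of directions encoding the multi-index `α`: direction `dir i` repeated `α i`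
times. -/
def dirList {V : Type*} {n : ℕ} (α : Fin n → ℕ) (dir : Fin n → V) : List V :=
  (List.ofFn fun i => List.replicate (α i) (dir i)).flatten

/-- The mixed partial derivative `∂_x^α ∂_ξ^β σ` of a symbol `σ(x,ξ)` on `ℝⁿ × ℝⁿ`. -/
def mixD (n : ℕ) (α β : Fin n → ℕ) (σ : En n × En n → ℂ) : En n × En n → ℂ :=
  pdSeq (dirList α (fun i => (unitE n i, (0 : En n))) ++
    dirList β (fun i => ((0 : En n), unitE n i))) σ

/-- The Hörmander class `S^m_{ρ,δ}`: `σ` is smooth and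
`|∂_x^α ∂_ξ^β σ(x,ξ)| ≤ C_{α,β} (1+|ξ|)^{m − ρ|β| + δ|α|}`. -/
def IsHormander (n : ℕ) (m ρ δ : ℝ) (σ : En n × En n → ℂ) : Prop :=
  ContDiff ℝ (⊤ : ℕ∞) σ ∧
  ∀ α β : Fin n → ℕ, ∃ C : ℝ, ∀ x ξ : En n,
    ‖mixD n α β σ (x, ξ)‖ ≤
      C * (1 + ‖ξ‖) ^ (m - ρ * (∑ i, (β i : ℝ)) + δ * (∑ i, (α i : ℝ)))

/-- The difference operator `Δ_h g(X) = g(X+h) − g(X)`. -/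
def idiff {V : Type*} [Add V] (h : V) (g : V → ℂ) : V → ℂ := fun X => g (X + h) - g X

/-- The Besov `B^{α,∞}_∞` norm (valued in `ℝ≥0∞`):
`‖g‖_∞ + sup_{h≠0} |h|^{−α} ‖Δ_h^{α+1} g‖_∞`. -/
def besovE (n : ℕ) (α : ℕ) (g : En n → ℂ) : ℝ≥0∞ :=
  (⨆ x, (‖g x‖₊ : ℝ≥0∞)) +
    ⨆ (h : En n) (_ : h ≠ 0),
      ((‖h‖₊ : ℝ≥0∞) ^ (α : ℝ))⁻¹ * ⨆ x, (‖(idiff h)^[α + 1] g x‖₊ : ℝ≥0∞)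

/-- The partial derivative `∂_ξ^β σ` in the `ξ`-variables only. -/
def xiD (n : ℕ) (β : Fin n → ℕ) (σ : En n × En n → ℂ) : En n → En n → ℂ :=
  fun x => pdSeq (dirList β (unitE n)) (fun ξ => σ (x, ξ))

/-- The class `S̃^m_{ρ,δ}`: `σ(x,ξ)` is smooth in `ξ`, its `ξ`-derivatives are continuous,
and `‖∂_ξ^β σ(·,ξ)‖_{B^{α,∞}_∞} ≤ C_{α,β} (1+|ξ|)^{m − ρ|β| + δα}` (the Besov norm taken in
the `x`-variable). -/
def IsTilde (n : ℕ) (m ρ δ : ℝ) (σ : En n × En n → ℂ) : Prop :=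
  (∀ x : En n, ContDiff ℝ (⊤ : ℕ∞) fun ξ => σ (x, ξ)) ∧
  (∀ β : Fin n → ℕ, Continuous fun X : En n × En n => xiD n β σ X.1 X.2) ∧
  ∀ (β : Fin n → ℕ) (α : ℕ), ∃ C : ℝ, ∀ ξ : En n,
    besovE n α (fun x => xiD n β σ x ξ) ≤
      ENNReal.ofReal (C * (1 + ‖ξ‖) ^ (m - ρ * (∑ i, (β i : ℝ)) + δ * α))

/-- Line derivatives as one-variable derivatives at an arbitrary time. -/
theorem line_hasDerivAt {V : Type*} [NormedAddCommGroup V] [NormedSpace ℝ V] {f g : V → ℂ} {v : V}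
    (hd : ∀ x, HasLineDerivAt ℝ f (g x) x v) (y : V) (t : ℝ) :
    HasDerivAt (fun t : ℝ => f (y + t • v)) (g (y + t • v)) t := by
  have := hd (y + t • v)
  unfold HasLineDerivAt at this
  have h3 : HasDerivAt (fun u : ℝ => u - t) 1 t := (hasDerivAt_id t).sub_const t
  have h4 := HasDerivAt.scomp t (by simpa using this) h3
  simp only [one_smul] at h4
  refine h4.congr_of_eventuallyEq (Filter.Eventually.of_forall fun u => ?_)
  simp only [Function.comp]
  congr 1
  rw [sub_smul]; abel

/-- Continuous partial derivatives imply differentiability (Finset form). -/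
theorem aux_partial {V : Type*} [NormedAddCommGroup V] [NormedSpace ℝ V] {ι : Type*} [Fintype ι]
    (v : ι → V) (f : V → ℂ) (g : ι → V → ℂ) (hg : ∀ i, Continuous (g i))
    (hd : ∀ i x, HasLineDerivAt ℝ f (g i x) x (v i)) (x : V) (s : Finset ι) :
    (fun c : ι → ℝ => f (x + ∑ i ∈ s, c i • v i) - f x - ∑ i ∈ s, (c i : ℂ) * g i x)
      =o[nhds 0] fun c => c := by
  classical
  induction s using Finset.induction_on with
  | empty => simp
  | insert a s ha ih =>
    have key : (fun c : ι → ℝ => f ((x + ∑ i ∈ s, c i • v i) + c a • v a) -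
        f (x + ∑ i ∈ s, c i • v i) - (c a : ℂ) * g a x) =o[nhds 0] fun c => c := by
      rw [Asymptotics.isLittleO_iff]
      intro ε hε
      obtain ⟨δ, hδ, hδ'⟩ := Metric.continuousAt_iff.1 ((hg a).continuousAt (x := x)) ε hε
      have h1 : Filter.Tendsto (fun c : ι → ℝ => ‖∑ i ∈ s, c i • v i‖ + ‖c a • v a‖) (nhds 0)
          (nhds 0) := by
        have : Continuous (fun c : ι → ℝ => ‖∑ i ∈ s, c i • v i‖ + ‖c a • v a‖) := by fun_prop
        simpa using this.tendsto 0
      filter_upwards [h1.eventually (gt_mem_nhds hδ)] with c hc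
      set y := x + ∑ i ∈ s, c i • v i with hy
      have hder : ∀ t : ℝ, HasDerivAt (fun t : ℝ => f (y + t • v a) - (t : ℂ) * g a x)
          (g a (y + t • v a) - g a x) t := by
        intro t
        have e1 : HasDerivAt (fun t : ℝ => f (y + t • v a)) (g a (y + t • v a)) t :=
          line_hasDerivAt (hd a) y t
        have e2 : HasDerivAt (fun t : ℝ => (t : ℂ) * g a x) (g a x) t := by
          simpa using (Complex.ofRealCLM.hasDerivAt (x := t)).mul_const (g a x)
        exact e1.sub e2
      have hm := Convex.norm_image_sub_le_of_norm_hasDerivWithin_le (s := Set.uIcc 0 (c a))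
        (f := fun t : ℝ => f (y + t • v a) - (t : ℂ) * g a x) (C := ε) (x := 0) (y := c a)
        (fun t _ => (hder t).hasDerivWithinAt) (fun t ht => by
          rw [← dist_eq_norm]
          refine (hδ' ?_).le
          rw [dist_eq_norm, hy]
          have : ‖t • v a‖ ≤ ‖c a • v a‖ := by
            rw [norm_smul, norm_smul]
            gcongr
            rcases Set.mem_uIcc.1 ht with h | h
            · rw [Real.norm_eq_abs, Real.norm_eq_abs, abs_of_nonneg h.1,
                abs_of_nonneg (h.1.trans h.2)]; exact h.2
            · rw [Real.norm_eq_abs, Real.norm_eq_abs, abs_of_nonpos h.2,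
                abs_of_nonpos (h.1.trans h.2)]; linarith
          calc ‖x + ∑ i ∈ s, c i • v i + t • v a - x‖ = ‖∑ i ∈ s, c i • v i + t • v a‖ := by
                congr 1; abel
            _ ≤ ‖∑ i ∈ s, c i • v i‖ + ‖t • v a‖ := norm_add_le _ _
            _ < δ := by linarith)
        (convex_uIcc _ _) Set.left_mem_uIcc Set.right_mem_uIcc
      have e : f (y + c a • v a) - f y - (c a : ℂ) * g a x =
        (f (y + c a • v a) - (c a : ℂ) * g a x) - (f (y + (0:ℝ) • v a) - ((0:ℝ) : ℂ) * g a x) := by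
        simp; ring
      rw [e]
      refine hm.trans ?_
      gcongr
      simpa using norm_le_pi_norm c a
    refine (ih.add key).congr_left fun c => ?_
    rw [Finset.sum_insert ha, Finset.sum_insert ha]
    rw [show x + (c a • v a + ∑ i ∈ s, c i • v i) = x + ∑ i ∈ s, c i • v i + c a • v a by abel]
    ring

theorem aux_fderiv {V : Type*} [NormedAddCommGroup V] [NormedSpace ℝ V] [FiniteDimensional ℝ V]
    {ι : Type*} [Fintype ι] (b : Module.Basis ι ℝ V) (f : V → ℂ) (g : ι → V → ℂ)
    (hg : ∀ i, Continuous (g i)) (hd : ∀ i x, HasLineDerivAt ℝ f (g i x) x (b i)) (x : V) :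
    HasFDerivAt f (∑ i, (LinearMap.toContinuousLinearMap (b.coord i)).smulRight (g i x)) x := by
  have h := aux_partial b f g hg hd x Finset.univ
  rw [hasFDerivAt_iff_isLittleO_nhds_zero]
  have hL : Continuous (b.equivFun : V → ι → ℝ) :=
    LinearMap.continuous_of_finiteDimensional (b.equivFun : V →ₗ[ℝ] ι → ℝ)
  have ht : Filter.Tendsto (b.equivFun : V → ι → ℝ) (nhds 0) (nhds 0) := by
    simpa using hL.tendsto 0
  have h2 := h.comp_tendsto ht
  have hO : (fun h : V => b.equivFun h) =O[nhds 0] fun h => h :=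
    (LinearMap.toContinuousLinearMap (b.equivFun : V →ₗ[ℝ] ι → ℝ)).isBigO_id _
  refine (h2.trans_isBigO hO).congr_left fun c => ?_
  simp only [Function.comp]
  rw [Module.Basis.sum_equivFun]
  simp

theorem aux_contDiff {V : Type*} [NormedAddCommGroup V] [NormedSpace ℝ V] [FiniteDimensional ℝ V]
    {ι : Type*} [Fintype ι] (b : Module.Basis ι ℝ V) (G : Set (V → ℂ))
    (hc : ∀ f ∈ G, Continuous f)
    (hd : ∀ f ∈ G, ∀ i, ∃ g ∈ G, ∀ x, HasLineDerivAt ℝ f (g x) x (b i)) :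
    ∀ f ∈ G, ContDiff ℝ (⊤ : ℕ∞) f := by
  have : ∀ k : ℕ, ∀ f ∈ G, ContDiff ℝ k f := by
    intro k
    induction k with
    | zero => intro f hf; simpa using (contDiff_zero (𝕜 := ℝ)).2 (hc f hf)
    | succ k ih =>
      intro f hf
      choose g hgG hg using hd f hf
      have hF := aux_fderiv b f g (fun i => hc _ (hgG i)) hg
      rw [show ((k + 1 : ℕ) : WithTop ℕ∞) = (k : WithTop ℕ∞) + 1 by push_cast; rfl,
        contDiff_succ_iff_fderiv]
      refine ⟨fun x => (hF x).differentiableAt, by simp, ?_⟩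
      rw [show fderiv ℝ f = fun x => _ from funext fun x => (hF x).fderiv]
      refine ContDiff.sum fun i _ => ?_
      exact contDiff_const.smulRight (ih _ (hgG i))
  intro f hf
  exact contDiff_infty.2 fun k => this k f hf


section pd
variable {V W : Type*} [NormedAddCommGroup V] [NormedSpace ℝ V]
  [NormedAddCommGroup W] [NormedSpace ℝ W]

theorem pdSeq_cons (v : V) (L : List V) (f : V → ℂ) (x : V) :
    pdSeq (v :: L) f x = fderiv ℝ (pdSeq L f) x v := rfl

theorem pdSeq_append (L M : List V) (f : V → ℂ) :
    pdSeq (L ++ M) f = pdSeq L (pdSeq M f) := by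
  simp [pdSeq, List.foldr_append]

theorem contDiff_dir {f : V → ℂ} (hf : ContDiff ℝ (⊤ : ℕ∞) f) (v : V) :
    ContDiff ℝ (⊤ : ℕ∞) (fun x => fderiv ℝ f x v) := by
  have := (contDiff_infty_iff_fderiv.1 hf).2
  exact this.clm_apply contDiff_const

theorem contDiff_pdSeq (L : List V) {f : V → ℂ} (hf : ContDiff ℝ (⊤ : ℕ∞) f) :
    ContDiff ℝ (⊤ : ℕ∞) (pdSeq L f) := by
  induction L with
  | nil => exact hf
  | cons v L ih => exact contDiff_dir ih v

theorem fderiv_swap {f : V → ℂ} (hf : ContDiff ℝ (⊤ : ℕ∞) f) (v w : V) (x : V) :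
    fderiv ℝ (fun y => fderiv ℝ f y v) x w = fderiv ℝ (fun y => fderiv ℝ f y w) x v := by
  have h1 := (contDiff_infty_iff_fderiv.1 hf).2
  have h2 : DifferentiableAt ℝ (fderiv ℝ f) x := (h1.differentiable (by simp)) x
  have hs : IsSymmSndFDerivAt ℝ f x := by
    apply hf.contDiffAt.isSymmSndFDerivAt
    simp only [minSmoothness_of_isRCLikeNormedField]
    exact WithTop.coe_le_coe.2 (le_top : (2 : ℕ∞) ≤ ⊤)
  have e : ∀ u : V, fderiv ℝ (fun y => fderiv ℝ f y u) x = (fderiv ℝ (fderiv ℝ f) x).flip u := by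
    intro u
    rw [fderiv_clm_apply h2 (differentiableAt_const u)]
    simp
  rw [e, e]
  exact hs w v

theorem pdSeq_perm {L M : List V} (h : L.Perm M) {f : V → ℂ} (hf : ContDiff ℝ (⊤ : ℕ∞) f) :
    pdSeq L f = pdSeq M f := by
  induction h with
  | nil => rfl
  | cons v _ ih => funext x; rw [pdSeq_cons, pdSeq_cons, ih]
  | swap v w L =>
    funext x
    exact fderiv_swap (contDiff_pdSeq L hf) v w x
  | trans _ _ ih1 ih2 => exact ih1.trans ih2

theorem pdSeq_comp (A : V →L[ℝ] W) (c : W) (L : List V) {f : W → ℂ}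
    (hf : ContDiff ℝ (⊤ : ℕ∞) f) (y : V) :
    pdSeq (L.map A) f (A y + c) = pdSeq L (fun y => f (A y + c)) y := by
  induction L generalizing y with
  | nil => rfl
  | cons v L ih =>
    rw [List.map_cons, pdSeq_cons, pdSeq_cons]
    rw [show pdSeq L (fun y => f (A y + c)) = fun y => pdSeq (L.map A) f (A y + c) from
      funext fun y => (ih y).symm]
    have h1 : HasFDerivAt (fun y => A y + c) A y := A.hasFDerivAt.add_const c
    have h2 : DifferentiableAt ℝ (pdSeq (L.map A) f) (A y + c) :=
      (contDiff_pdSeq _ hf).differentiable (by simp) _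
    have h3 := HasFDerivAt.comp y h2.hasFDerivAt h1
    have h4 := h3.fderiv
    simp only [Function.comp_def] at h4
    rw [h4]; rfl

end pd

theorem pdSeq_slice_xi {n : ℕ} (L : List (En n)) {σ : En n × En n → ℂ}
    (hσ : ContDiff ℝ (⊤ : ℕ∞) σ) (x ξ : En n) :
    pdSeq (L.map fun v => ((0 : En n), v)) σ (x, ξ) = pdSeq L (fun ξ => σ (x, ξ)) ξ := by
  have := pdSeq_comp (ContinuousLinearMap.inr ℝ (En n) (En n)) (x, 0) L hσ ξ
  rw [show (fun v => ((0 : En n), v)) = ContinuousLinearMap.inr ℝ (En n) (En n) by ext v <;> simp]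
  simpa using this

theorem pdSeq_slice_x {n : ℕ} (L : List (En n)) {σ : En n × En n → ℂ}
    (hσ : ContDiff ℝ (⊤ : ℕ∞) σ) (x ξ : En n) :
    pdSeq (L.map fun v => (v, (0 : En n))) σ (x, ξ) = pdSeq L (fun x => σ (x, ξ)) x := by
  have := pdSeq_comp (ContinuousLinearMap.inl ℝ (En n) (En n)) (0, ξ) L hσ x
  rw [show (fun v => (v, (0 : En n))) = ContinuousLinearMap.inl ℝ (En n) (En n) by ext v <;> simp]
  simpa using this

theorem dirList_map {V W : Type*} {n : ℕ} (α : Fin n → ℕ) (dir : Fin n → V) (g : V → W) :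
    dirList α (fun i => g (dir i)) = (dirList α dir).map g := by
  simp [dirList, List.map_flatten, List.map_ofFn, Function.comp_def]

theorem dirList_length {n : ℕ} {V : Type*} (α : Fin n → ℕ) (dir : Fin n → V) :
    (dirList α dir).length = ∑ i, α i := by
  simp [dirList, List.length_flatten, List.map_ofFn, Function.comp_def, List.sum_ofFn]

theorem perm_dirList {n : ℕ} (J : List (Fin n)) :
    J.Perm (dirList (fun i => J.count i) (fun i => i)) := by
  rw [List.perm_iff_count]
  intro a
  simp [dirList, List.count_flatten, List.map_ofFn, Function.comp_def, List.sum_ofFn,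
    List.count_replicate]

theorem sum_count {n : ℕ} (J : List (Fin n)) : ∑ i, J.count i = J.length := by
  rw [(perm_dirList J).length_eq, dirList_length]

theorem xiD_eq {n : ℕ} (β : Fin n → ℕ) {σ : En n × En n → ℂ}
    (hσ : ContDiff ℝ (⊤ : ℕ∞) σ) (x ξ : En n) :
    xiD n β σ x ξ = pdSeq (dirList β (fun i => ((0 : En n), unitE n i))) σ (x, ξ) := by
  rw [dirList_map β (unitE n) (fun v => ((0 : En n), v)), pdSeq_slice_xi _ hσ]
  rfl


section diffs
variable {V : Type*} [NormedAddCommGroup V] [NormedSpace ℝ V]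


theorem idiff_iter_bound (h : V) (k : ℕ) {g : V → ℂ} {C : ℝ} (hC : ∀ x, ‖g x‖ ≤ C) (x : V) :
    ‖(idiff h)^[k] g x‖ ≤ 2 ^ k * C := by
  induction k generalizing x with
  | zero => simpa using hC x
  | succ k ih =>
    rw [Function.iterate_succ_apply']
    calc ‖idiff h ((idiff h)^[k] g) x‖ ≤ ‖(idiff h)^[k] g (x + h)‖ + ‖(idiff h)^[k] g x‖ :=
          norm_sub_le _ _
      _ ≤ 2 ^ k * C + 2 ^ k * C := add_le_add (ih _) (ih _)
      _ = 2 ^ (k + 1) * C := by ring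

theorem contDiff_idiff (h : V) {g : V → ℂ} (hg : ContDiff ℝ (⊤ : ℕ∞) g) :
    ContDiff ℝ (⊤ : ℕ∞) (idiff h g) :=
  (hg.comp (contDiff_id.add contDiff_const)).sub hg

theorem pdSeq_idiff (h : V) (L : List V) {g : V → ℂ} (hg : ContDiff ℝ (⊤ : ℕ∞) g) :
    pdSeq L (idiff h g) = idiff h (pdSeq L g) := by
  induction L with
  | nil => rfl
  | cons v L ih =>
    funext x
    rw [pdSeq_cons, ih]
    have hd := (contDiff_pdSeq L hg).differentiable (by simp)
    unfold idiff
    rw [fderiv_fun_sub, fderiv_comp_add_right]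
    · rfl
    · exact (hd (x + h)).comp x (differentiableAt_id.add_const h)
    · exact hd x

theorem idiff_iter_le_deriv (h : V) (k : ℕ) {g : V → ℂ} (hg : ContDiff ℝ (⊤ : ℕ∞) g) {B : ℝ}
    (hB : ∀ x, ‖pdSeq (List.replicate k h) g x‖ ≤ B) (x : V) : ‖(idiff h)^[k] g x‖ ≤ B := by
  induction k generalizing g x with
  | zero => simpa [pdSeq] using hB x
  | succ k ih =>
    rw [Function.iterate_succ_apply]
    refine ih (contDiff_idiff h hg) (fun y => ?_) x
    rw [pdSeq_idiff h _ hg]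
    set G := pdSeq (List.replicate k h) g with hG
    have hGd : Differentiable ℝ G := (contDiff_pdSeq _ hg).differentiable (by simp)
    have hder : ∀ t : ℝ, HasDerivAt (fun t : ℝ => G (y + t • h)) (fderiv ℝ G (y + t • h) h) t :=
      line_hasDerivAt (g := fun z => fderiv ℝ G z h)
        (fun z => (hGd z).hasFDerivAt.hasLineDerivAt h) y
    have := norm_image_sub_le_of_norm_deriv_le_segment_01' (f := fun t : ℝ => G (y + t • h))
      (C := B) (fun t _ => (hder t).hasDerivWithinAt) (fun t _ => hB _)
    simpa [idiff] using this

end diffs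

theorem nn_eq {V : Type*} [SeminormedAddCommGroup V] (x : V) :
    (‖x‖₊ : ℝ≥0∞) = ENNReal.ofReal ‖x‖ := (ofReal_norm x).symm

theorem norm_coord_le {n : ℕ} (h : En n) (i : Fin n) : ‖h i‖ ≤ ‖h‖ := PiLp.norm_apply_le h i

theorem sum_unitE {n : ℕ} (h : En n) : ∑ i, h i • unitE n i = h := by
  ext j
  simp [unitE, Pi.single_apply]

theorem pdSeq_dir_bound {n : ℕ} {g : En n → ℂ} (hg : ContDiff ℝ (⊤ : ℕ∞) g) {B : ℝ} (K : ℕ)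
    (hB : ∀ J : List (Fin n), J.length = K → ∀ x, ‖pdSeq (J.map (unitE n)) g x‖ ≤ B)
    (h : En n) (k : ℕ) : ∀ J : List (Fin n), k + J.length = K → ∀ x,
      ‖pdSeq (List.replicate k h ++ J.map (unitE n)) g x‖ ≤ (n * ‖h‖) ^ k * B := by
  induction k with
  | zero => intro J hJ x; simpa using hB J (by omega) x
  | succ k ih =>
    intro J hJ x
    rw [List.replicate_succ, List.cons_append, pdSeq_cons]
    nth_rewrite 2 [← sum_unitE h]
    rw [map_sum]
    have : ∀ i, ‖(fderiv ℝ (pdSeq (List.replicate k h ++ J.map (unitE n)) g) x)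
        (h i • unitE n i)‖ ≤ ‖h‖ * ((n * ‖h‖) ^ k * B) := by
      intro i
      rw [map_smul, norm_smul]
      refine mul_le_mul (norm_coord_le h i) ?_ (norm_nonneg _) (norm_nonneg _)
      have h2 := ih (i :: J) (by simp; omega) x
      rw [List.map_cons, pdSeq_perm List.perm_middle hg] at h2
      exact h2
    refine (norm_sum_le_of_le _ fun i _ => this i).trans (le_of_eq ?_)
    simp
    ring

theorem part_one {n : ℕ} {m ρ δ : ℝ} (hδ : 0 ≤ δ) {σ : En n × En n → ℂ}
    (H : IsHormander n m ρ δ σ) : IsTilde n m ρ δ σ := by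
  obtain ⟨hs, hb⟩ := H
  refine ⟨fun x => hs.comp (contDiff_prodMk_right x), fun β => ?_, fun β k => ?_⟩
  · have : (fun X : En n × En n => xiD n β σ X.1 X.2) =
        pdSeq (dirList β (fun i => ((0 : En n), unitE n i))) σ :=
      funext fun X => xiD_eq β hs X.1 X.2
    rw [this]
    exact (contDiff_pdSeq _ hs).continuous
  · choose C hC using fun α => hb α β
    set M : ℝ := ∑ α ∈ Fintype.piFinset (fun _ : Fin n => Finset.range (k + 1)), |C α| with hM
    have hM0 : 0 ≤ M := Finset.sum_nonneg fun _ _ => abs_nonneg _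
    have hCM : ∀ α : Fin n → ℕ, ∑ i, α i ≤ k → C α ≤ M := by
      intro α hα
      refine (le_abs_self _).trans ?_
      refine Finset.single_le_sum (f := fun α => |C α|) (fun _ _ => abs_nonneg _) ?_
      rw [Fintype.mem_piFinset]
      intro i
      have := Finset.single_le_sum (f := α) (fun _ _ => Nat.zero_le _) (Finset.mem_univ i)
      rw [Finset.mem_range]; omega
    refine ⟨M + 2 * n ^ k * M, fun ξ => ?_⟩
    set R : ℝ := 1 + ‖ξ‖ with hR
    have hR1 : 1 ≤ R := by rw [hR]; linarith [norm_nonneg ξ]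
    set W : ℝ := R ^ (m - ρ * (∑ i, (β i : ℝ)) + δ * k) with hW
    have hW0 : 0 < W := Real.rpow_pos_of_pos (by linarith) _
    set F := pdSeq (dirList β (fun i => ((0 : En n), unitE n i))) σ with hF
    have hFs : ContDiff ℝ (⊤ : ℕ∞) F := contDiff_pdSeq _ hs
    set g : En n → ℂ := fun x => xiD n β σ x ξ with hg
    have hgF : g = fun x => F (x, ξ) := funext fun x => xiD_eq β hs x ξ
    have hgs : ContDiff ℝ (⊤ : ℕ∞) g := by
      rw [hgF]; exact hFs.comp (contDiff_prodMk_left ξ)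
    have hder : ∀ J : List (Fin n), J.length ≤ k → ∀ x, ‖pdSeq (J.map (unitE n)) g x‖ ≤ M * W := by
      intro J hJ x
      have h1 := hC (fun i => J.count i) x ξ
      have e : pdSeq (J.map (unitE n)) g x = mixD n (fun i => J.count i) β σ (x, ξ) := by
        rw [hgF, ← pdSeq_slice_x _ hFs, mixD, pdSeq_append, ← hF,
          dirList_map _ (unitE n) (fun v => (v, (0 : En n))),
          dirList_map _ (fun i => i) (unitE n)]
        rw [pdSeq_perm (((perm_dirList J).map _).map _) hFs]
      rw [e]
      refine h1.trans ?_
      have h2 : C (fun i => J.count i) ≤ M := hCM _ (by rw [sum_count]; exact hJ)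
      have h3 : (∑ i, ((J.count i : ℕ) : ℝ)) ≤ k := by
        rw [← Nat.cast_sum, sum_count]; exact_mod_cast hJ
      refine mul_le_mul h2 ?_ (by positivity) hM0
      exact Real.rpow_le_rpow_of_exponent_le hR1 (by gcongr)
    have hsup : ∀ x, ‖g x‖ ≤ M * W := fun x => hder [] (by simp) x
    have hdiff : ∀ h x, ‖(idiff h)^[k + 1] g x‖ ≤ ‖h‖ ^ k * (2 * n ^ k * M * W) := by
      intro h x
      rw [Function.iterate_succ_apply']
      have h1 : ∀ y, ‖(idiff h)^[k] g y‖ ≤ (n * ‖h‖) ^ k * (M * W) := by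
        refine idiff_iter_le_deriv h k hgs fun y => ?_
        have := pdSeq_dir_bound hgs k (fun J hJ => hder J hJ.le) h k [] (by simp) y
        simpa using this
      have h2 := idiff_iter_bound h 1 h1 x
      refine h2.trans (le_of_eq ?_)
      rw [mul_pow]; ring
    rw [add_mul, ENNReal.ofReal_add (by positivity) (by positivity)]
    unfold besovE
    refine add_le_add (iSup_le fun x => ?_) (iSup_le fun h => iSup_le fun hh => ?_)
    · rw [nn_eq]
      exact ENNReal.ofReal_le_ofReal (hsup x)
    · have hpos : 0 < ‖h‖ := norm_pos_iff.2 hh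
      have e1 : ((‖h‖₊ : ℝ≥0∞) ^ (k : ℝ)) = ENNReal.ofReal (‖h‖ ^ k) := by
        rw [ENNReal.rpow_natCast, ENNReal.ofReal_pow (norm_nonneg _)]
        rw [nn_eq]
      rw [e1, ← ENNReal.ofReal_inv_of_pos (by positivity)]
      calc _ ≤ ENNReal.ofReal (‖h‖ ^ k)⁻¹ * ENNReal.ofReal (‖h‖ ^ k * (2 * n ^ k * M * W)) := by
            gcongr
            refine iSup_le fun x => ?_
            rw [nn_eq]
            exact ENNReal.ofReal_le_ofReal (hdiff h x)
        _ = _ := by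
            rw [← ENNReal.ofReal_mul (by positivity)]
            congr 1
            field_simp


section marchaud
variable {V : Type*} [NormedAddCommGroup V] [NormedSpace ℝ V]

/-- The sum operator `g(X+h) + g(X)`. -/
def isum {V : Type*} [Add V] (h : V) (g : V → ℂ) : V → ℂ := fun X => g (X + h) + g X

theorem isum_iter_bound {V : Type*} [AddCommGroup V] (h : V) (N : ℕ) {u : V → ℂ} {D : ℝ}
    (hD : ∀ x, ‖idiff h u x‖ ≤ D) (x : V) :
    ‖(isum h)^[N] u x - 2 ^ N * u x‖ ≤ N * 2 ^ N * D := by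
  have hD0 : 0 ≤ D := (norm_nonneg _).trans (hD x)
  induction N generalizing x with
  | zero => simp
  | succ N ih =>
    rw [Function.iterate_succ_apply']
    have e : isum h ((isum h)^[N] u) x - 2 ^ (N + 1) * u x =
        ((isum h)^[N] u (x + h) - 2 ^ N * u (x + h)) + ((isum h)^[N] u x - 2 ^ N * u x)
          + 2 ^ N * idiff h u x := by
      simp only [isum, idiff]; ring
    rw [e]
    refine (norm_add₃_le).trans ?_
    have h3 : ‖(2 : ℂ) ^ N * idiff h u x‖ ≤ 2 ^ N * D := by
      rw [norm_mul]
      have : ‖(2 : ℂ) ^ N‖ = 2 ^ N := by simp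
      rw [this]; gcongr; exact hD x
    have h4 : (0 : ℝ) ≤ 2 ^ N * D := by positivity
    push_cast
    rw [pow_succ]
    nlinarith [ih x, ih (x + h)]

theorem idiff_double {V : Type*} [AddCommGroup V] (h : V) (N : ℕ) (g : V → ℂ) :
    (idiff (h + h))^[N] g = (isum h)^[N] ((idiff h)^[N] g) := by
  have hc : Function.Commute (isum h) (idiff h) := by
    intro u
    funext x
    simp only [isum, idiff]; ring
  have e : idiff (h + h) = (isum h) ∘ (idiff h) := by
    funext u x
    simp only [isum, idiff, Function.comp, ← add_assoc]; ring
  rw [e, hc.comp_iterate]; rfl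

theorem q_double {y : ℝ} (hy : 0 ≤ y) : 2 * y * √(2 * y) ≤ 3 * (y * √y) := by
  rw [Real.sqrt_mul (by norm_num)]
  have h2 : √2 ≤ 3 / 2 := by
    rw [Real.sqrt_le_left (by norm_num)]; norm_num
  have : 0 ≤ y * √y := by positivity
  nlinarith

theorem marchaud_step {g : V → ℂ} {B A l : ℝ} (hl : 0 < l) (hB : ∀ x, ‖g x‖ ≤ B) (hA : 0 ≤ A)
    {N : ℕ} (hN : 2 ≤ N)
    (H : ∀ h, h ≠ 0 → ∀ x, ‖(idiff h)^[N + 1] g x‖ ≤ A * (l * ‖h‖ * √(l * ‖h‖))) :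
    ∀ h, h ≠ 0 → ∀ x, ‖(idiff h)^[N] g x‖ ≤ 4 * N * A * (l * ‖h‖ * √(l * ‖h‖)) := by
  have h2N : (4 : ℝ) ≤ 2 ^ N := by
    calc (4 : ℝ) = 2 ^ 2 := by norm_num
      _ ≤ 2 ^ N := pow_le_pow_right₀ (by norm_num) hN
  have step : ∀ h, h ≠ 0 → ∀ x, 2 ^ N * ‖(idiff h)^[N] g x‖ ≤
      ‖(idiff (h + h))^[N] g x‖ + 2 ^ N * (N * A * (l * ‖h‖ * √(l * ‖h‖))) := by
    intro h hh x
    have h1 := isum_iter_bound h N (u := (idiff h)^[N] g) (fun y => by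
      rw [← Function.iterate_succ_apply' (idiff h)]; exact H h hh y) x
    rw [← idiff_double] at h1
    have h2 := norm_sub_norm_le ((2 : ℂ) ^ N * (idiff h)^[N] g x) ((idiff (h + h))^[N] g x)
    rw [norm_sub_rev] at h2
    have h3 : ‖(2 : ℂ) ^ N * (idiff h)^[N] g x‖ = 2 ^ N * ‖(idiff h)^[N] g x‖ := by simp
    rw [h3] at h2
    nlinarith
  have claim : ∀ j : ℕ, ∀ h, h ≠ 0 → ∀ x, ‖(idiff h)^[N] g x‖ ≤
      (1 / 4) ^ j * (2 ^ N * B) + 4 * N * A * (l * ‖h‖ * √(l * ‖h‖)) := by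
    intro j
    induction j with
    | zero =>
      intro h hh x
      have := idiff_iter_bound h N hB x
      have h0 : 0 ≤ 4 * N * A * (l * ‖h‖ * √(l * ‖h‖)) := by positivity
      simp only [pow_zero, one_mul]; linarith
    | succ j ih =>
      intro h hh x
      have hh2 : h + h ≠ 0 := by
        rw [← two_smul ℝ h]; exact smul_ne_zero (by norm_num) hh
      have hn : ‖h + h‖ = 2 * ‖h‖ := by rw [← two_smul ℝ h, norm_smul]; simp
      have h1 := ih (h + h) hh2 x
      rw [hn, show l * (2 * ‖h‖) = 2 * (l * ‖h‖) by ring] at h1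
      have h2 := q_double (y := l * ‖h‖) (by positivity)
      have h3 := step h hh x
      set Q := l * ‖h‖ * √(l * ‖h‖) with hQ
      have hQ0 : 0 ≤ Q := by positivity
      set T := ‖(idiff h)^[N] g x‖
      have h4 : 4 * N * A * (2 * (l * ‖h‖) * √(2 * (l * ‖h‖))) ≤ 4 * N * A * (3 * Q) := by
        gcongr
      have hNAQ : 0 ≤ N * A * Q := by positivity
      have hB0 : 0 ≤ B := (norm_nonneg _).trans (hB x)
      have hJ : 0 ≤ (1 / 4 : ℝ) ^ j * (2 ^ N * B) := by positivity
      set J := (1 / 4 : ℝ) ^ j * (2 ^ N * B)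
      have h5 : 2 ^ N * T ≤ J + 12 * (N * A * Q) + 2 ^ N * (N * A * Q) := by nlinarith
      have h6 : 2 ^ N * T ≤ 2 ^ N * (1 / 4 * J + 4 * (N * A * Q)) := by nlinarith
      have h7 := le_of_mul_le_mul_left h6 (by positivity)
      calc T ≤ 1 / 4 * J + 4 * (N * A * Q) := h7
        _ = _ := by rw [pow_succ]; ring
  intro h hh x
  have ht : Filter.Tendsto (fun j : ℕ => (1 / 4 : ℝ) ^ j * (2 ^ N * B) +
      4 * N * A * (l * ‖h‖ * √(l * ‖h‖))) Filter.atTop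
      (nhds (0 * (2 ^ N * B) + 4 * N * A * (l * ‖h‖ * √(l * ‖h‖)))) :=
    ((tendsto_pow_atTop_nhds_zero_of_lt_one (by norm_num) (by norm_num)).mul_const _).add_const _
  have := ge_of_tendsto' ht fun j => claim j h hh x
  simpa using this

theorem marchaud (N : ℕ) : ∃ c : ℝ, 0 ≤ c ∧ ∀ (g : V → ℂ) (B A l : ℝ), 0 < l →
    (∀ x, ‖g x‖ ≤ B) → 0 ≤ A →
    (∀ h, h ≠ 0 → ∀ x, ‖(idiff h)^[N + 2] g x‖ ≤ A * (l * ‖h‖ * √(l * ‖h‖))) →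
    ∀ h, h ≠ 0 → ∀ x, ‖(idiff h)^[2] g x‖ ≤ c * A * (l * ‖h‖ * √(l * ‖h‖)) := by
  induction N with
  | zero => exact ⟨1, by norm_num, fun g B A l _ _ _ H => by simpa using H⟩
  | succ N ih =>
    obtain ⟨c, hc, ih⟩ := ih
    refine ⟨c * (4 * (N + 2 : ℕ)), by positivity, fun g B A l hl hB hA H h hh x => ?_⟩
    have h1 := marchaud_step (N := N + 2) hl hB hA (by omega) (by
      rw [show N + 2 + 1 = N + 1 + 2 by ring]; exact H)
    have h2 := ih g B _ l hl hB (by positivity) h1 h hh x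
    exact h2.trans (le_of_eq (by ring))

end marchaud


/-- Families (indexed by `ξ`) of functions of `x` with uniform (weighted) difference bounds. -/
structure Tame {n : ℕ} (w l : En n → ℝ) (f : En n × En n → ℂ) : Prop where
  wcont : Continuous w
  wpos : ∀ ξ, 0 < w ξ
  lcont : Continuous l
  lpos : ∀ ξ, 0 < l ξ
  cont : Continuous f
  bdd : ∃ C, 0 ≤ C ∧ ∀ x ξ, ‖f (x, ξ)‖ ≤ C * w ξ
  diff : ∀ k : ℕ, ∃ N : ℕ, ∃ C, 0 ≤ C ∧ ∀ ξ h, h ≠ 0 → ∀ x,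
    ‖(idiff h)^[N] (fun x => f (x, ξ)) x‖ ≤ C * w ξ * (l ξ * ‖h‖) ^ k

theorem min_q {y a c : ℝ} (hy : 0 < y) (hc : 0 ≤ c) (h1 : a ≤ c) (h2 : a ≤ c * y ^ 2) :
    a ≤ c * (y * √y) := by
  rcases le_total y 1 with h | h
  · refine h2.trans ?_
    have : y ≤ √y := Real.le_sqrt_of_sq_le (by nlinarith)
    gcongr
    nlinarith
  · refine h1.trans ?_
    have : 1 ≤ √y := Real.one_le_sqrt.2 h
    have : 1 ≤ y * √y := by nlinarith
    nlinarith

theorem Tame.second {n : ℕ} {w l : En n → ℝ} {f : En n × En n → ℂ} (T : Tame w l f) :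
    ∃ C, 0 ≤ C ∧ ∀ ξ h, h ≠ 0 → ∀ x,
      ‖(idiff h)^[2] (fun x => f (x, ξ)) x‖ ≤ C * w ξ * (l ξ * ‖h‖ * √(l ξ * ‖h‖)) := by
  obtain ⟨B, hB0, hB⟩ := T.bdd
  obtain ⟨N, C, hC0, hC⟩ := T.diff 2
  obtain ⟨c, hc0, hc⟩ := marchaud (V := En n) N
  refine ⟨c * (4 * C + 2 ^ (N + 2) * B), by positivity, fun ξ h hh x => ?_⟩
  have hw := T.wpos ξ
  have hl := T.lpos ξ
  have := hc (fun x => f (x, ξ)) (B * w ξ) ((4 * C + 2 ^ (N + 2) * B) * w ξ) (l ξ) hl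
    (fun x => hB x ξ) (by positivity) (fun h hh x => by
      have hpos : 0 < ‖h‖ := norm_pos_iff.2 hh
      refine min_q (by positivity) (by positivity) ?_ ?_
      · refine (idiff_iter_bound h (N + 2) (fun x => hB x ξ) x).trans ?_
        have : 0 ≤ 4 * C * w ξ := by positivity
        linarith
      · rw [add_comm N 2, Function.iterate_add_apply]
        refine (idiff_iter_bound h 2 (fun x => hC ξ h hh x) x).trans ?_
        have : 0 ≤ 2 ^ (2 + N) * B * w ξ * (l ξ * ‖h‖) ^ 2 := by positivity
        linarith) h hh x
  refine this.trans (le_of_eq (by ring))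

/-- Difference quotient in the `x` direction `v`. -/
def dq {n : ℕ} (v : En n) (t : ℝ) (f : En n × En n → ℂ) (X : En n × En n) : ℂ :=
  (t : ℂ)⁻¹ * (f (X + t • (v, (0 : En n))) - f X)

theorem dq_apply {n : ℕ} (v : En n) (t : ℝ) (f : En n × En n → ℂ) (x ξ : En n) :
    dq v t f (x, ξ) = (t : ℂ)⁻¹ * (f (x + t • v, ξ) - f (x, ξ)) := by
  simp [dq]

theorem sqrt_half_pow (a : ℝ) (ha : 0 ≤ a) (i : ℕ) :
    √(a * (1 / 2) ^ i) ≤ √a * (3 / 4) ^ i := by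
  rw [Real.sqrt_le_left (by positivity), mul_pow, Real.sq_sqrt ha]
  gcongr
  rw [← pow_mul, mul_comm i 2, pow_mul]
  gcongr
  norm_num

/-- The basic constant of a tame family: second-difference constant. -/
def SecBound {n : ℕ} (w l : En n → ℝ) (f : En n × En n → ℂ) (C : ℝ) : Prop :=
  0 ≤ C ∧ ∀ ξ h, h ≠ 0 → ∀ x,
      ‖(idiff h)^[2] (fun x => f (x, ξ)) x‖ ≤ C * w ξ * (l ξ * ‖h‖ * √(l ξ * ‖h‖))

theorem dq_half {n : ℕ} {w l : En n → ℝ} {f : En n × En n → ℂ} {C : ℝ} (T : Tame w l f)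
    (hC : SecBound w l f C) {v : En n} (hv : ‖v‖ = 1) {t : ℝ} (ht : 0 < t) (x ξ : En n) :
    ‖dq v t f (x, ξ) - dq v (t / 2) f (x, ξ)‖ ≤ C * (w ξ * l ξ) * √(l ξ * t) := by
  have hw := T.wpos ξ
  have hl := T.lpos ξ
  have hC0 := hC.1
  have hv0 : v ≠ 0 := by rw [← norm_pos_iff, hv]; norm_num
  have h1 := hC.2 ξ ((t / 2) • v) (smul_ne_zero (by positivity) hv0) x
  have hn : ‖(t / 2) • v‖ = t / 2 := by
    rw [norm_smul, hv, mul_one, Real.norm_of_nonneg (by positivity)]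
  rw [hn] at h1
  have e : dq v t f (x, ξ) - dq v (t / 2) f (x, ξ) =
      (t : ℂ)⁻¹ * (idiff ((t / 2) • v))^[2] (fun x => f (x, ξ)) x := by
    rw [dq_apply, dq_apply]
    have e2 : x + (t / 2) • v + (t / 2) • v = x + t • v := by
      rw [add_assoc, ← add_smul]; congr 2; ring
    simp only [Function.iterate_succ, Function.iterate_zero, Function.comp, id, idiff, e2]
    have : (t : ℂ) ≠ 0 := by exact_mod_cast ht.ne'
    push_cast
    field_simp
    ring
  rw [e, norm_mul, norm_inv, Complex.norm_real, Real.norm_of_nonneg ht.le]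
  have hs : √(l ξ * (t / 2)) ≤ √(l ξ * t) := Real.sqrt_le_sqrt (by nlinarith)
  calc t⁻¹ * ‖(idiff ((t / 2) • v))^[2] (fun x => f (x, ξ)) x‖
      ≤ t⁻¹ * (C * w ξ * (l ξ * (t / 2) * √(l ξ * (t / 2)))) := by gcongr
    _ = C * (w ξ * l ξ) * √(l ξ * (t / 2)) / 2 := by field_simp
    _ ≤ C * (w ξ * l ξ) * √(l ξ * t) / 2 := by gcongr
    _ ≤ C * (w ξ * l ξ) * √(l ξ * t) := by
      have : 0 ≤ C * (w ξ * l ξ) * √(l ξ * t) := by positivity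
      linarith

theorem dq_geom {n : ℕ} {w l : En n → ℝ} {f : En n × En n → ℂ} {C : ℝ} (T : Tame w l f)
    (hC : SecBound w l f C) {v : En n} (hv : ‖v‖ = 1) {t : ℝ} (ht : 0 < t) (x ξ : En n) (i : ℕ) :
    dist (dq v (t * (1 / 2) ^ i) f (x, ξ)) (dq v (t * (1 / 2) ^ (i + 1)) f (x, ξ)) ≤
      C * (w ξ * l ξ) * √(l ξ * t) * (3 / 4) ^ i := by
  have h := dq_half T hC hv (t := t * (1 / 2) ^ i) (by positivity) x ξ
  rw [dist_eq_norm, pow_succ]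
  rw [show t * ((1 / 2) ^ i * (1 / 2)) = t * (1 / 2) ^ i / 2 by ring]
  refine h.trans ?_
  have hw := T.wpos ξ
  have hl := T.lpos ξ
  have hC0 := hC.1
  rw [← mul_assoc (l ξ), mul_assoc _ (√(l ξ * t))]
  gcongr
  exact sqrt_half_pow _ (by positivity) i

theorem dq_limit_bound {n : ℕ} {w l : En n → ℝ} {f : En n × En n → ℂ} {C : ℝ} (T : Tame w l f)
    (hC : SecBound w l f C) {v : En n} (hv : ‖v‖ = 1) {t : ℝ} (ht : 0 < t) (x ξ : En n) {a : ℂ}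
    (ha : Filter.Tendsto (fun i : ℕ => dq v (t * (1 / 2) ^ i) f (x, ξ)) Filter.atTop (nhds a)) :
    ‖dq v t f (x, ξ) - a‖ ≤ 4 * C * (w ξ * l ξ) * √(l ξ * t) := by
  have := dist_le_of_le_geometric_of_tendsto₀ (3 / 4) _ (by norm_num) (dq_geom T hC hv ht x ξ) ha
  rw [dist_eq_norm] at this
  simp only [pow_zero, mul_one] at this
  refine this.trans (le_of_eq (by ring))

theorem dq_exists_limit {n : ℕ} {w l : En n → ℝ} {f : En n × En n → ℂ} {C : ℝ} (T : Tame w l f)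
    (hC : SecBound w l f C) {v : En n} (hv : ‖v‖ = 1) (X : En n × En n) :
    ∃ a, Filter.Tendsto (fun i : ℕ => dq v ((1 / 2) ^ i) f X) Filter.atTop (nhds a) := by
  have := cauchySeq_of_le_geometric (3 / 4) _ (by norm_num) (dq_geom T hC hv one_pos X.1 X.2)
  simp only [one_mul] at this
  exact cauchySeq_tendsto_of_complete this

theorem dq_half_bound {n : ℕ} {w l : En n → ℝ} {f : En n × En n → ℂ} {C : ℝ} (T : Tame w l f)
    (hC : SecBound w l f C) {v : En n} (hv : ‖v‖ = 1) {G : En n × En n → ℂ}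
    (hG : ∀ X, Filter.Tendsto (fun i : ℕ => dq v ((1 / 2) ^ i) f X) Filter.atTop (nhds (G X)))
    (X : En n × En n) (j : ℕ) :
    ‖dq v ((1 / 2) ^ j) f X - G X‖ ≤ 4 * C * (w X.2 * l X.2) * (√(l X.2) * (3 / 4) ^ j) := by
  have hw := T.wpos X.2
  have hl := T.lpos X.2
  have hC0 := hC.1
  have h1 : Filter.Tendsto (fun i : ℕ => dq v ((1 / 2) ^ j * (1 / 2) ^ i) f (X.1, X.2))
      Filter.atTop (nhds (G X)) := by
    simp only [← pow_add]
    simpa [add_comm] using (Filter.tendsto_add_atTop_iff_nat j).2 (hG X)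
  refine (dq_limit_bound T hC hv (by positivity) X.1 X.2 h1).trans ?_
  gcongr
  exact sqrt_half_pow _ hl.le j

theorem dq_locunif {n : ℕ} {w l : En n → ℝ} {f : En n × En n → ℂ} {C : ℝ} (T : Tame w l f)
    (hC : SecBound w l f C) {v : En n} (hv : ‖v‖ = 1) {G : En n × En n → ℂ}
    (hG : ∀ X, Filter.Tendsto (fun i : ℕ => dq v ((1 / 2) ^ i) f X) Filter.atTop (nhds (G X))) :
    TendstoLocallyUniformly (fun (j : ℕ) X => dq v ((1 / 2) ^ j) f X) G Filter.atTop := by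
  rw [Metric.tendstoLocallyUniformly_iff]
  intro ε hε X
  set Φ : En n × En n → ℝ := fun Y => 4 * C * (w Y.2 * l Y.2) * √(l Y.2) with hΦ
  have hΦc : Continuous Φ := by
    have := T.wcont
    have := T.lcont
    fun_prop
  have hev : ∀ᶠ Y in nhds X, Φ Y < Φ X + 1 := hΦc.continuousAt.eventually (gt_mem_nhds (by linarith))
  have hΦ0 : 0 ≤ Φ X := by
    have := T.wpos X.2
    have := T.lpos X.2
    have := hC.1
    positivity
  refine ⟨_, hev, ?_⟩
  have ht : Filter.Tendsto (fun j : ℕ => (Φ X + 1) * (3 / 4 : ℝ) ^ j) Filter.atTop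
      (nhds ((Φ X + 1) * 0)) :=
    (tendsto_pow_atTop_nhds_zero_of_lt_one (by norm_num) (by norm_num)).const_mul _
  rw [mul_zero] at ht
  filter_upwards [ht.eventually (gt_mem_nhds hε)] with j hj Y hY
  rw [dist_comm, dist_eq_norm]
  refine (dq_half_bound T hC hv hG Y j).trans_lt ?_
  refine lt_of_le_of_lt ?_ hj
  rw [← mul_assoc]
  gcongr


theorem half_pow_tendsto : Filter.Tendsto (fun j : ℕ => (1 / 2 : ℝ) ^ j) Filter.atTop
    (nhdsWithin 0 (Set.Ioi 0)) :=
  tendsto_nhdsWithin_iff.2 ⟨tendsto_pow_atTop_nhds_zero_of_lt_one (by norm_num) (by norm_num),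
    Filter.Eventually.of_forall fun j => by simp⟩

theorem half_pow_tendsto' {t : ℝ} (ht : 0 < t) :
    Filter.Tendsto (fun j : ℕ => t * (1 / 2 : ℝ) ^ j) Filter.atTop (nhdsWithin 0 {0}ᶜ) := by
  refine tendsto_nhdsWithin_iff.2 ⟨?_, Filter.Eventually.of_forall fun j => ?_⟩
  · simpa using (tendsto_pow_atTop_nhds_zero_of_lt_one (r := (1 / 2 : ℝ))
      (by norm_num) (by norm_num)).const_mul t
  · have : t * (1 / 2 : ℝ) ^ j ≠ 0 := by positivity
    simpa using this

theorem dq_hasLineDerivAt {n : ℕ} {w l : En n → ℝ} {f : En n × En n → ℂ} {C : ℝ}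
    (T : Tame w l f) (hC : SecBound w l f C) {v : En n} (hv : ‖v‖ = 1) {G : En n × En n → ℂ}
    (hG : ∀ X, Filter.Tendsto (fun i : ℕ => dq v ((1 / 2) ^ i) f X) Filter.atTop (nhds (G X)))
    (X : En n × En n) : HasLineDerivAt ℝ f (G X) X (v, (0 : En n)) := by
  set u : En n × En n := (v, 0) with hu
  set p : ℝ → ℂ := fun s => f (X + s • u) with hp
  have hpc : Continuous p := by
    have := T.cont
    fun_prop
  set P : ℝ → ℂ := fun s => ∫ r in (0 : ℝ)..s, p r with hP
  have hPd : ∀ s, HasDerivAt P (p s) s := fun s =>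
    intervalIntegral.integral_hasDerivAt_right (hpc.intervalIntegrable _ _)
      (hpc.stronglyMeasurableAtFilter _ _) hpc.continuousAt
  set F : ℕ → ℝ → ℂ := fun j s => (((1 / 2 : ℝ) ^ j : ℝ) : ℂ)⁻¹ * (P (s + (1 / 2) ^ j) - P s) with hF
  have hFd : ∀ j s, HasDerivAt (F j) (dq v ((1 / 2) ^ j) f (X + s • u)) s := by
    intro j s
    have h1 : HasDerivAt (fun s => P (s + (1 / 2) ^ j)) (p (s + (1 / 2) ^ j)) s :=
      HasDerivAt.comp_add_const s _ (hPd _)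
    have h2 := (h1.sub (hPd s)).const_mul ((((1 / 2 : ℝ) ^ j : ℝ) : ℂ)⁻¹)
    have h3 : HasDerivAt (F j) _ s := h2
    refine h3.congr_deriv ?_
    change _ * (f (X + (s + (1 / 2) ^ j) • u) - f (X + s • u)) =
      _ * (f (X + s • u + ((1 / 2 : ℝ) ^ j) • u) - f (X + s • u))
    rw [add_smul, add_assoc]
  have hFt : ∀ s, Filter.Tendsto (fun j => F j s) Filter.atTop (nhds (p s)) := by
    intro s
    have h1 := (hPd s).tendsto_slope_zero
    have h2 := h1.comp (by simpa using half_pow_tendsto' one_pos :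
      Filter.Tendsto (fun j : ℕ => (1 / 2 : ℝ) ^ j) Filter.atTop (nhdsWithin 0 {0}ᶜ))
    refine h2.congr fun j => ?_
    simp only [Function.comp, hF, Complex.real_smul, Complex.ofReal_inv]
  have hloc : TendstoLocallyUniformly (fun (j : ℕ) (s : ℝ) => dq v ((1 / 2) ^ j) f (X + s • u))
      (fun s : ℝ => G (X + s • u)) Filter.atTop := by
    have := (dq_locunif T hC hv hG).comp (fun s : ℝ => X + s • u) (by fun_prop)
    exact this
  have := hasDerivAt_of_tendstoLocallyUniformlyOn (s := Set.univ) (x := (0 : ℝ)) isOpen_univ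
    (tendstoLocallyUniformlyOn_univ.2 hloc) (Filter.Eventually.of_forall fun j s _ => hFd j s)
    (fun s _ => hFt s) (Set.mem_univ _)
  simpa [HasLineDerivAt] using this

theorem idiff_iter_dq {V : Type*} [AddCommGroup V] (h a : V) (c : ℂ) (N : ℕ) (g : V → ℂ) (x : V) :
    (idiff h)^[N] (fun x => c * (g (x + a) - g x)) x =
      c * ((idiff h)^[N] g (x + a) - (idiff h)^[N] g x) := by
  induction N generalizing x with
  | zero => rfl
  | succ N ih =>
    rw [Function.iterate_succ_apply', Function.iterate_succ_apply']
    simp only [idiff]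
    rw [ih, ih, show x + h + a = x + a + h by abel]
    ring

theorem idiff_iter_sub {V : Type*} [AddCommGroup V] (h : V) (N : ℕ) (g g' : V → ℂ) (x : V) :
    (idiff h)^[N] (fun x => g x - g' x) x = (idiff h)^[N] g x - (idiff h)^[N] g' x := by
  induction N generalizing x with
  | zero => rfl
  | succ N ih =>
    rw [Function.iterate_succ_apply', Function.iterate_succ_apply', Function.iterate_succ_apply']
    simp only [idiff]
    rw [ih, ih]
    ring

theorem dq_full_bound {n : ℕ} {w l : En n → ℝ} {f : En n × En n → ℂ} {C : ℝ}
    (T : Tame w l f) (hC : SecBound w l f C) {v : En n} (hv : ‖v‖ = 1) {G : En n × En n → ℂ}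
    (hG : ∀ X, HasLineDerivAt ℝ f (G X) X (v, (0 : En n))) {t : ℝ} (ht : 0 < t) (x ξ : En n) :
    ‖dq v t f (x, ξ) - G (x, ξ)‖ ≤ 4 * C * (w ξ * l ξ) * √(l ξ * t) := by
  refine dq_limit_bound T hC hv ht x ξ ?_
  have h1 := hasLineDerivAt_iff_tendsto_slope_zero.1 (hG (x, ξ))
  refine (h1.comp (half_pow_tendsto' ht)).congr fun j => ?_
  simp only [Function.comp, dq, Complex.real_smul, Complex.ofReal_inv]

theorem Tame.deriv {n : ℕ} {w l : En n → ℝ} {f : En n × En n → ℂ} (T : Tame w l f)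
    {v : En n} (hv : ‖v‖ = 1) : ∃ G : En n × En n → ℂ, Tame (fun ξ => w ξ * l ξ) l G ∧
      (∀ X, HasLineDerivAt ℝ f (G X) X (v, (0 : En n))) ∧
      TendstoLocallyUniformly (fun (j : ℕ) X => dq v ((1 / 2) ^ j) f X) G Filter.atTop := by
  obtain ⟨C, hC⟩ := T.second
  replace hC : SecBound w l f C := hC
  have hC0 := hC.1
  choose G hG using dq_exists_limit T hC hv
  have hL := dq_hasLineDerivAt T hC hv hG
  have hU := dq_locunif T hC hv hG
  obtain ⟨B, hB0, hB⟩ := T.bdd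
  refine ⟨G, ⟨T.wcont.mul T.lcont, fun ξ => mul_pos (T.wpos ξ) (T.lpos ξ), T.lcont, T.lpos, ?_,
    ⟨4 * C + 2 * B, by positivity, fun x ξ => ?_⟩, fun k => ?_⟩, hL, hU⟩
  · refine hU.continuous (Filter.Frequently.of_forall fun j => ?_)
    have := T.cont
    unfold dq
    fun_prop
  · have hw := T.wpos ξ
    have hl := T.lpos ξ
    have h1 := dq_full_bound T hC hv hL (t := (l ξ)⁻¹) (by positivity) x ξ
    rw [mul_inv_cancel₀ hl.ne', Real.sqrt_one, mul_one] at h1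
    have h2 : ‖dq v (l ξ)⁻¹ f (x, ξ)‖ ≤ l ξ * (2 * (B * w ξ)) := by
      rw [dq_apply, norm_mul, norm_inv, Complex.norm_real, Real.norm_of_nonneg (by positivity),
        inv_inv]
      gcongr
      refine (norm_sub_le _ _).trans ?_
      linarith [hB (x + (l ξ)⁻¹ • v) ξ, hB x ξ]
    have h3 := norm_sub_norm_le (G (x, ξ)) (dq v (l ξ)⁻¹ f (x, ξ))
    rw [norm_sub_rev] at h3
    calc ‖G (x, ξ)‖ ≤ l ξ * (2 * (B * w ξ)) + 4 * C * (w ξ * l ξ) := by linarith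
      _ = _ := by ring
  · obtain ⟨N, C', hC'0, hC'⟩ := T.diff (3 * k)
    refine ⟨N, 2 ^ N * (4 * C) + 2 * C', by positivity, fun ξ h hh x => ?_⟩
    have hw := T.wpos ξ
    have hl := T.lpos ξ
    have hh0 : 0 < ‖h‖ := norm_pos_iff.2 hh
    set y := l ξ * ‖h‖ with hy
    have hy0 : 0 < y := by positivity
    set t := y ^ (2 * k) / l ξ with ht
    have ht0 : 0 < t := by positivity
    have hlt : √(l ξ * t) = y ^ k := by
      rw [ht, mul_div_cancel₀ _ hl.ne', mul_comm 2 k, pow_mul, Real.sqrt_sq (by positivity)]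
    have h1 : ∀ z, ‖(fun x => dq v t f (x, ξ) - G (x, ξ)) z‖ ≤ 4 * C * (w ξ * l ξ) * y ^ k := by
      intro z
      have := dq_full_bound T hC hv hL ht0 z ξ
      rwa [hlt] at this
    have h2 := idiff_iter_bound h N h1 x
    rw [idiff_iter_sub h N (fun x => dq v t f (x, ξ)) (fun x => G (x, ξ)) x] at h2
    have h3 : ‖(idiff h)^[N] (fun x => dq v t f (x, ξ)) x‖ ≤
        t⁻¹ * (2 * (C' * w ξ * y ^ (3 * k))) := by
      rw [show (fun x => dq v t f (x, ξ)) =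
        (fun x => (t : ℂ)⁻¹ * ((fun x => f (x, ξ)) (x + t • v) - (fun x => f (x, ξ)) x)) from
          funext fun x => dq_apply v t f x ξ]
      rw [idiff_iter_dq h (t • v) (t : ℂ)⁻¹ N (fun x => f (x, ξ)) x, norm_mul, norm_inv, Complex.norm_real, Real.norm_of_nonneg ht0.le]
      gcongr
      refine (norm_sub_le _ _).trans ?_
      linarith [hC' ξ h hh (x + t • v), hC' ξ h hh x]
    have h4 : t⁻¹ * (2 * (C' * w ξ * y ^ (3 * k))) = 2 * C' * (w ξ * l ξ) * y ^ k := by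
      rw [ht, show 3 * k = 2 * k + k by ring, pow_add]
      field_simp
    have h5 := norm_sub_norm_le ((idiff h)^[N] (fun x => G (x, ξ)) x)
      ((idiff h)^[N] (fun x => dq v t f (x, ξ)) x)
    rw [norm_sub_rev] at h5
    calc ‖(idiff h)^[N] (fun x => G (x, ξ)) x‖ ≤ 2 ^ N * (4 * C * (w ξ * l ξ) * y ^ k) +
          2 * C' * (w ξ * l ξ) * y ^ k := by linarith
      _ = _ := by ring

/-- Swapping `∂_x` and `∂_ξ`. -/
theorem swap_deriv {n : ℕ} {f f2 G G2 : En n × En n → ℂ} {v : En n} {η : En n × En n}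
    (hf : ∀ X, HasLineDerivAt ℝ f (f2 X) X η)
    (hG : TendstoLocallyUniformly (fun (j : ℕ) X => dq v ((1 / 2) ^ j) f X) G Filter.atTop)
    (hG2 : TendstoLocallyUniformly (fun (j : ℕ) X => dq v ((1 / 2) ^ j) f2 X) G2 Filter.atTop)
    (X : En n × En n) : HasLineDerivAt ℝ G (G2 X) X η := by
  have hloc : TendstoLocallyUniformly (fun (j : ℕ) (s : ℝ) => dq v ((1 / 2) ^ j) f2 (X + s • η))
      (fun s : ℝ => G2 (X + s • η)) Filter.atTop :=
    hG2.comp (fun s : ℝ => X + s • η) (by fun_prop)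
  have hd : ∀ (j : ℕ) (s : ℝ), HasDerivAt (fun s : ℝ => dq v ((1 / 2) ^ j) f (X + s • η))
      (dq v ((1 / 2) ^ j) f2 (X + s • η)) s := by
    intro j s
    have h1 := line_hasDerivAt hf (X + ((1 / 2 : ℝ) ^ j) • (v, (0 : En n))) s
    have h2 := line_hasDerivAt hf X s
    have h3 := (h1.sub h2).const_mul ((((1 / 2 : ℝ) ^ j : ℝ) : ℂ)⁻¹)
    unfold dq
    simp only [add_right_comm X _ (((1 / 2 : ℝ) ^ j) • (v, (0 : En n)))]
    exact h3
  have := hasDerivAt_of_tendstoLocallyUniformlyOn (s := Set.univ) (x := (0 : ℝ))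
    (g := fun s : ℝ => G (X + s • η)) isOpen_univ
    (tendstoLocallyUniformlyOn_univ.2 hloc) (Filter.Eventually.of_forall fun j s _ => hd j s)
    (fun s _ => (tendstoLocallyUniformlyOn_univ.2 hG).tendsto_at (Set.mem_univ (X + s • η))) (Set.mem_univ _)
  simpa [HasLineDerivAt] using this



theorem tame_base {n : ℕ} {m ρ δ : ℝ} {σ : En n × En n → ℂ} (H : IsTilde n m ρ δ σ)
    (β : Fin n → ℕ) :
    Tame (fun ξ : En n => (1 + ‖ξ‖) ^ (m - ρ * (∑ i, (β i : ℝ)))) (fun ξ => (1 + ‖ξ‖) ^ δ)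
      (fun X => xiD n β σ X.1 X.2) := by
  have hpos : ∀ ξ : En n, 0 < 1 + ‖ξ‖ := fun ξ => by positivity
  have hcont : ∀ s : ℝ, Continuous fun ξ : En n => (1 + ‖ξ‖) ^ s := fun s =>
    (continuous_const.add continuous_norm).rpow_const fun ξ => Or.inl (hpos ξ).ne'
  have hwk : ∀ (k : ℕ) (ξ : En n), (1 + ‖ξ‖) ^ (m - ρ * (∑ i, (β i : ℝ)) + δ * k) =
      (1 + ‖ξ‖) ^ (m - ρ * (∑ i, (β i : ℝ))) * ((1 + ‖ξ‖) ^ δ) ^ k := fun k ξ => by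
    rw [Real.rpow_add (hpos ξ), Real.rpow_mul_natCast (hpos ξ).le]
  refine ⟨hcont _, fun ξ => Real.rpow_pos_of_pos (hpos ξ) _, hcont _,
    fun ξ => Real.rpow_pos_of_pos (hpos ξ) _, H.2.1 β, ?_, fun k => ?_⟩
  · obtain ⟨C, hC⟩ := H.2.2 β 0
    refine ⟨|C|, abs_nonneg _, fun x ξ => ?_⟩
    have h1 : (‖xiD n β σ x ξ‖₊ : ℝ≥0∞) ≤ besovE n 0 (fun x => xiD n β σ x ξ) :=
      (le_iSup (fun x => (‖xiD n β σ x ξ‖₊ : ℝ≥0∞)) x).trans le_self_add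
    have h2 := h1.trans (hC ξ)
    have hP := Real.rpow_pos_of_pos (hpos ξ) (m - ρ * (∑ i, (β i : ℝ)) + δ * (0 : ℕ))
    have h3 := h2.trans (ENNReal.ofReal_le_ofReal
      (mul_le_mul_of_nonneg_right (le_abs_self C) hP.le))
    rw [nn_eq, ENNReal.ofReal_le_ofReal_iff (by positivity), hwk] at h3
    simpa using h3
  · obtain ⟨C, hC⟩ := H.2.2 β k
    refine ⟨k + 1, |C|, abs_nonneg _, fun ξ h hh x => ?_⟩
    have hn : 0 < ‖h‖ := norm_pos_iff.2 hh
    set g : En n → ℂ := fun x => xiD n β σ x ξ with hg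
    have h1 : ((‖h‖₊ : ℝ≥0∞) ^ (k : ℝ))⁻¹ * (‖(idiff h)^[k + 1] g x‖₊ : ℝ≥0∞) ≤
        besovE n k g := by
      unfold besovE
      refine le_trans ?_ le_add_self
      refine le_trans ?_ (le_iSup₂ (f := fun (h : En n) (_ : h ≠ 0) =>
        ((‖h‖₊ : ℝ≥0∞) ^ (k : ℝ))⁻¹ * ⨆ x, (‖(idiff h)^[k + 1] g x‖₊ : ℝ≥0∞)) h hh)
      gcongr
      exact le_iSup (fun x => (‖(idiff h)^[k + 1] g x‖₊ : ℝ≥0∞)) x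
    have hP := Real.rpow_pos_of_pos (hpos ξ) (m - ρ * (∑ i, (β i : ℝ)) + δ * k)
    have h3 := (h1.trans (hC ξ)).trans (ENNReal.ofReal_le_ofReal
      (mul_le_mul_of_nonneg_right (le_abs_self C) hP.le))
    have e1 : ((‖h‖₊ : ℝ≥0∞) ^ (k : ℝ)) = ENNReal.ofReal (‖h‖ ^ k) := by
      rw [ENNReal.rpow_natCast, ENNReal.ofReal_pow (norm_nonneg _)]
      rw [nn_eq]
    rw [e1, ← ENNReal.ofReal_inv_of_pos (by positivity), nn_eq,
      ← ENNReal.ofReal_mul (by positivity), ENNReal.ofReal_le_ofReal_iff (by positivity),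
      inv_mul_le_iff₀ (by positivity), hwk] at h3
    refine h3.trans (le_of_eq ?_)
    rw [mul_pow]; ring

/-- Families closed under `ξ`-derivatives all of whose members are tame. -/
def Good {n : ℕ} (l : En n → ℝ) (f : List (Fin n) → En n × En n → ℂ) : Prop :=
  (∀ M, ∃ w, Tame w l (f M)) ∧
    ∀ M a X, HasLineDerivAt ℝ (f M) (f (a :: M) X) X ((0 : En n), unitE n a)

theorem norm_unitE {n : ℕ} (i : Fin n) : ‖unitE n i‖ = 1 := by simp [unitE]

theorem Good.step {n : ℕ} {l : En n → ℝ} {f : List (Fin n) → En n × En n → ℂ} (H : Good l f)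
    (b : Fin n) : ∃ f', Good l f' ∧
      ∀ M X, HasLineDerivAt ℝ (f M) (f' M X) X (unitE n b, (0 : En n)) := by
  choose w hw using H.1
  choose f' h1 h2 h3 using fun M => (hw M).deriv (norm_unitE b)
  exact ⟨f', ⟨fun M => ⟨_, h1 M⟩, fun M a X =>
    swap_deriv (fun X => H.2 M a X) (h3 M) (h3 (a :: M)) X⟩, h2⟩

theorem good_base {n : ℕ} {m ρ δ : ℝ} {σ : En n × En n → ℂ} (H : IsTilde n m ρ δ σ) :
    Good (fun ξ => (1 + ‖ξ‖) ^ δ)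
      (fun M X => pdSeq (M.map (unitE n)) (fun ξ => σ (X.1, ξ)) X.2) := by
  refine ⟨fun M => ?_, fun M a X => ?_⟩
  · have := tame_base H (fun i => M.count i)
    have e : (fun X : En n × En n => pdSeq (M.map (unitE n)) (fun ξ => σ (X.1, ξ)) X.2) =
        fun X => xiD n (fun i => M.count i) σ X.1 X.2 := by
      funext X
      rw [xiD, dirList_map _ (fun i => i) (unitE n),
        pdSeq_perm ((perm_dirList M).map _) (H.1 X.1)]
    rw [← e] at this
    exact ⟨_, this⟩
  · have hd := (contDiff_pdSeq (M.map (unitE n)) (H.1 X.1)).differentiable (by simp) X.2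
    have := hd.hasFDerivAt.hasLineDerivAt (unitE n a)
    unfold HasLineDerivAt at this ⊢
    simpa [pdSeq_cons] using this

theorem tilde_smooth {n : ℕ} {m ρ δ : ℝ} {σ : En n × En n → ℂ} (H : IsTilde n m ρ δ σ) :
    ContDiff ℝ (⊤ : ℕ∞) σ := by
  let e := (EuclideanSpace.basisFun (Fin n) ℝ).toBasis
  refine aux_contDiff (e.prod e)
    {u | ∃ f, Good (fun ξ : En n => (1 + ‖ξ‖) ^ δ) f ∧ ∃ M, u = f M} ?_ ?_ σ
    ⟨_, good_base H, [], rfl⟩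
  · rintro _ ⟨f, hf, M, rfl⟩
    obtain ⟨w, hw⟩ := hf.1 M
    exact hw.cont
  · rintro _ ⟨f, hf, M, rfl⟩ (i | i)
    · obtain ⟨f', hf', h⟩ := hf.step i
      refine ⟨f' M, ⟨f', hf', M, rfl⟩, fun X => ?_⟩
      have : (e.prod e) (Sum.inl i) = (unitE n i, (0 : En n)) := by
        simp [e, unitE, Module.Basis.prod_apply]
      rw [this]
      exact h M X
    · refine ⟨f (i :: M), ⟨f, hf, _, rfl⟩, fun X => ?_⟩
      have : (e.prod e) (Sum.inr i) = ((0 : En n), unitE n i) := by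
        simp [e, unitE, Module.Basis.prod_apply]
      rw [this]
      exact hf.2 M i X

theorem tame_pdSeq {n : ℕ} {w l : En n → ℝ} {F : En n × En n → ℂ} (T : Tame w l F)
    (hF : ContDiff ℝ (⊤ : ℕ∞) F) (J : List (Fin n)) :
    Tame (fun ξ => w ξ * l ξ ^ J.length) l
      (pdSeq (J.map fun i => (unitE n i, (0 : En n))) F) := by
  induction J with
  | nil => simpa [pdSeq] using T
  | cons i J ih =>
    obtain ⟨G, hG, hd, -⟩ := ih.deriv (norm_unitE i)
    have hs := (contDiff_pdSeq (J.map fun i => (unitE n i, (0 : En n))) hF).differentiable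
      (by simp)
    have e : pdSeq ((i :: J).map fun i => (unitE n i, (0 : En n))) F = G := by
      funext X
      rw [List.map_cons, pdSeq_cons]
      exact ((hs X).hasFDerivAt.hasLineDerivAt _).unique (hd X)
    rw [e]
    simpa [pow_succ, mul_assoc] using hG

theorem part_two {n : ℕ} {m ρ δ τ : ℝ} (hτ : 0 < τ) {σ : En n × En n → ℂ}
    (H : IsTilde n m ρ δ σ) : IsHormander n m ρ (δ + τ) σ := by
  have hs := tilde_smooth H
  refine ⟨hs, fun α β => ?_⟩
  have e : (fun X : En n × En n => xiD n β σ X.1 X.2) =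
      pdSeq (dirList β (fun i => ((0 : En n), unitE n i))) σ :=
    funext fun X => xiD_eq β hs X.1 X.2
  have T := tame_base H β
  rw [e] at T
  have T2 := tame_pdSeq T (contDiff_pdSeq _ hs) (dirList α (fun i => i))
  obtain ⟨C, hC0, hC⟩ := T2.bdd
  refine ⟨C, fun x ξ => ?_⟩
  have hx := hC x ξ
  rw [← dirList_map α (fun i => i) (fun i => (unitE n i, (0 : En n))), ← pdSeq_append,
    dirList_length] at hx
  refine hx.trans ?_
  have hR : 1 ≤ 1 + ‖ξ‖ := by linarith [norm_nonneg ξ]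
  have hR0 : 0 < 1 + ‖ξ‖ := by linarith
  refine mul_le_mul_of_nonneg_left ?_ hC0
  rw [← Real.rpow_mul_natCast hR0.le, ← Real.rpow_add hR0]
  refine Real.rpow_le_rpow_of_exponent_le hR ?_
  push_cast
  have : 0 ≤ ∑ i, (α i : ℝ) := Finset.sum_nonneg fun _ _ => by positivity
  nlinarith


/-- For `m ∈ ℝ`, `ρ, δ ≥ 0` and `τ > 0`: every `σ ∈ S^m_{ρ,δ}` belongs to `S̃^m_{ρ,δ}`, and
every `σ ∈ S̃^m_{ρ,δ}` is smooth and belongs to `S^m_{ρ,δ+τ}`; that is,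
`S^m_{ρ,δ} ⊆ S̃^m_{ρ,δ} ⊆ S^m_{ρ,δ+τ}`. -/
theorem stmt_12 (n : ℕ) (hn : 1 ≤ n) (m ρ δ τ : ℝ) (hρ : 0 ≤ ρ) (hδ : 0 ≤ δ) (hτ : 0 < τ) :
    (∀ σ : En n × En n → ℂ, IsHormander n m ρ δ σ → IsTilde n m ρ δ σ) ∧
    (∀ σ : En n × En n → ℂ, IsTilde n m ρ δ σ → IsHormander n m ρ (δ + τ) σ) := by
  exact ⟨fun _ H => part_one hδ H, fun _ H => part_two hτ H⟩
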